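/- For every ε > 0, the function u(x) = x − V*_{1/2}(x/ε²)/V*_{1/2}(1/ε²) satisfies the boundary conditions u(0) = 0 and u(1) = 0, and for every x ∈ (0,1) it satisfies the Caputo fractional equation −ε·(1/Γ(1/2)) ∫_0^x (x − t)^{−1/2} u''(t) dt − u'(x) = −1. Thus u is an exact solution of the singularly perturbed Caputo fractional convection–diffusion boundary value problem −ε D^{3/2}_* u − u' = −1, u(0) = u(1) = 0. -/

import Mathlib

/-- `V*_{1/2}(ξ) = Σ_{k=1}^∞ ξ^k/k! − Σ_{k=1}^∞ ξ^{k+1/2}/Γ(k+3/2)`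
(sums written over `k : ℕ` with the index shifted by one;
`ξ ^ (k + 1/2)` is the real power `Real.rpow`). -/
noncomputable def Vstar (ξ : ℝ) : ℝ :=
  (∑' k : ℕ, ξ ^ (k + 1) / (Nat.factorial (k + 1) : ℝ)) -
  ∑' k : ℕ, ξ ^ (((k : ℝ) + 1) + 1 / 2) / Real.Gamma (((k : ℝ) + 1) + 3 / 2)

/-- Exact solution `u(x) = x − V*_{1/2}(x/ε²)/V*_{1/2}(1/ε²)` of the fractional
convection–diffusion boundary value problem with `α = 1/2`. -/
noncomputable def uFrac (ε x : ℝ) : ℝ := x - Vstar (x / ε ^ 2) / Vstar (1 / ε ^ 2)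

open MeasureTheory

theorem half_term {a x : ℝ} (ha : -1 < a) (hx : 0 < x) :
    ∫ t in (0:ℝ)..x, (x - t) ^ (-(1:ℝ)/2) * t ^ a
      = Real.Gamma (1/2) * Real.Gamma (a+1) * (x ^ (a + 1/2) / Real.Gamma (a + 3/2)) := by
  have h := Complex.betaIntegral_scaled (a+1 : ℂ) (1/2) hx
  rw [Complex.betaIntegral_eq_Gamma_mul_div _ _ (by simp; linarith) (by norm_num)] at h
  have e : (∫ t in (0:ℝ)..x, (t:ℂ) ^ ((a+1:ℂ) - 1) * ((x:ℂ) - t) ^ ((1/2:ℂ) - 1))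
     = ((∫ t in (0:ℝ)..x, (x - t) ^ (-(1:ℝ)/2) * t ^ a : ℝ) : ℂ) := by
    rw [← intervalIntegral.integral_ofReal]
    apply intervalIntegral.integral_congr
    intro t ht
    rw [Set.uIcc_of_le hx.le] at ht
    simp only []
    rw [Complex.ofReal_mul, Complex.ofReal_cpow ht.1, Complex.ofReal_cpow (by linarith [ht.2])]
    push_cast
    rw [mul_comm]
    congr 2 <;> ring
  rw [e] at h
  have e2 : (x:ℂ) ^ ((a+1:ℂ) + 1/2 - 1) = ((x ^ (a+1/2) : ℝ) : ℂ) := by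
    rw [Complex.ofReal_cpow hx.le]; push_cast; congr 1; ring
  have e3 : Complex.Gamma (a+1) = (Real.Gamma (a+1) : ℝ) := by
    rw [← Complex.Gamma_ofReal]; push_cast; rfl
  have e4 : Complex.Gamma (1/2) = (Real.Gamma (1/2) : ℝ) := by
    rw [← Complex.Gamma_ofReal]; push_cast; rfl
  have e5 : Complex.Gamma (a+1+1/2) = (Real.Gamma (a+3/2) : ℝ) := by
    rw [← Complex.Gamma_ofReal]; push_cast; congr 1; ring
  rw [e2, e3, e4, e5] at h
  have h2 : (∫ t in (0:ℝ)..x, (x - t) ^ (-(1:ℝ)/2) * t ^ a)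
      = x ^ (a+1/2) * (Real.Gamma (a+1) * Real.Gamma (1/2) / Real.Gamma (a+3/2)) := by
    exact_mod_cast h
  rw [h2]; ring

theorem half_term_integrable {a x : ℝ} (ha : -1 < a) (hx : 0 < x) :
    IntervalIntegrable (fun t => (x - t) ^ (-(1:ℝ)/2) * t ^ a) volume 0 x := by
  by_contra hc
  have h1 := half_term ha hx
  rw [intervalIntegral.integral_undef hc] at h1
  have := Real.Gamma_pos_of_pos (show (0:ℝ) < 1/2 by norm_num)
  have := Real.Gamma_pos_of_pos (show (0:ℝ) < a+1 by linarith)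
  have := Real.Gamma_pos_of_pos (show (0:ℝ) < a+3/2 by linarith)
  have := Real.rpow_pos_of_pos hx (a+1/2)
  have : 0 < Real.Gamma (1/2) * Real.Gamma (a+1) * (x ^ (a + 1/2) / Real.Gamma (a + 3/2)) := by
    positivity
  linarith

/-- the series `Σ x^(k+b)/Γ(k+b+1)` -/
noncomputable def EE (b x : ℝ) : ℝ := ∑' k : ℕ, x ^ ((k:ℝ) + b) / Real.Gamma ((k:ℝ) + b + 1)

theorem EE_summable {b x : ℝ} (hb : 0 ≤ b) (hx : 0 < x) :
    Summable fun k : ℕ => x ^ ((k:ℝ) + b) / Real.Gamma ((k:ℝ) + b + 1) := by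
  have hG : ∀ k : ℕ, Real.Gamma (b+1) * (k.factorial : ℝ) ≤ Real.Gamma ((k:ℝ) + b + 1) := by
    intro k
    induction k with
    | zero => simp
    | succ k ih =>
      have e : ((k + 1 : ℕ) : ℝ) + b + 1 = ((k:ℝ) + b + 1) + 1 := by push_cast; ring
      have hk0 : (0:ℝ) ≤ k := by positivity
      have hne : (k:ℝ) + b + 1 ≠ 0 := by positivity
      rw [e, Real.Gamma_add_one hne, Nat.factorial_succ, Nat.cast_mul, Nat.cast_add_one]
      have h0 := Real.Gamma_pos_of_pos (show (0:ℝ) < b+1 by linarith)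
      have : 0 < Real.Gamma (b+1) * (k.factorial : ℝ) := by positivity
      calc Real.Gamma (b+1) * (((k:ℝ)+1) * k.factorial)
          = ((k:ℝ)+1) * (Real.Gamma (b+1) * k.factorial) := by ring
        _ ≤ ((k:ℝ)+b+1) * Real.Gamma ((k:ℝ)+b+1) := by
            apply mul_le_mul _ ih this.le (by positivity)
            linarith
  have h0 := Real.Gamma_pos_of_pos (show (0:ℝ) < b+1 by linarith)
  refine Summable.of_nonneg_of_le (fun k => ?_) (fun k => ?_)
    ((Real.summable_pow_div_factorial x).mul_left (x ^ b / Real.Gamma (b+1)))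
  · have := Real.Gamma_pos_of_pos (show (0:ℝ) < (k:ℝ)+b+1 by positivity)
    positivity
  · rw [Real.rpow_add hx, Real.rpow_natCast, div_mul_div_comm, mul_comm (x ^ k)]
    have : 0 < (k.factorial : ℝ) := by positivity
    gcongr
    exact hG k

theorem half_EE {b x : ℝ} (hb : -(1/2) ≤ b) (hx : 0 < x) :
    ∫ t in (0:ℝ)..x, (x - t) ^ (-(1:ℝ)/2) * EE b t = Real.Gamma (1/2) * EE (b + 1/2) x := by
  have hs := EE_summable (b := b + 1/2) (by linarith) hx
  have hG : ∀ k : ℕ, 0 < Real.Gamma ((k:ℝ) + b + 1) := fun k =>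
    Real.Gamma_pos_of_pos (by have : (0:ℝ) ≤ k := by positivity
                              linarith)
  have hk : ∀ k : ℕ, -1 < (k:ℝ) + b := fun k => by
    have : (0:ℝ) ≤ k := by positivity
    linarith
  set F : ℕ → ℝ → ℝ := fun k t => (x - t) ^ (-(1:ℝ)/2) * t ^ ((k:ℝ)+b) / Real.Gamma ((k:ℝ) + b + 1)
    with hF
  have hFi : ∀ k, IntervalIntegrable (F k) volume 0 x := fun k =>
    (half_term_integrable (hk k) hx).div_const _
  have hFv : ∀ k, ∫ t in (0:ℝ)..x, F k t =
      Real.Gamma (1/2) * (x ^ ((k:ℝ) + (b + 1/2)) / Real.Gamma ((k:ℝ) + (b+1/2) + 1)) := by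
    intro k
    rw [hF, intervalIntegral.integral_div, half_term (hk k) hx]
    have := (hG k).ne'
    rw [show (k:ℝ) + b + 3/2 = (k:ℝ) + (b+1/2) + 1 by ring, ← add_assoc (k:ℝ) b (1/2)]
    field_simp
  have hn : ∀ k, ∫ t in Set.Ioc 0 x, ‖F k t‖ = ∫ t in (0:ℝ)..x, F k t := by
    intro k
    rw [intervalIntegral.integral_of_le hx.le]
    apply setIntegral_congr_fun measurableSet_Ioc
    intro t ht
    have h1 : 0 ≤ x - t := by linarith [ht.2]
    have h2 := ht.1.le
    have h3 := (hG k).le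
    exact Real.norm_of_nonneg (by positivity)
  have key := hasSum_integral_of_summable_integral_norm (μ := volume.restrict (Set.Ioc 0 x))
    (F := F) (fun k => ((intervalIntegrable_iff_integrableOn_Ioc_of_le hx.le).1 (hFi k)))
    (by simp_rw [hn, hFv]; exact hs.mul_left _)
  have key2 := key.tsum_eq
  rw [← intervalIntegral.integral_of_le hx.le] at key2
  simp_rw [← intervalIntegral.integral_of_le hx.le, hFv] at key2
  rw [tsum_mul_left] at key2
  rw [EE, key2]
  congr 1
  ext t
  rw [EE, ← tsum_mul_left]
  simp only [hF, mul_div_assoc]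

theorem EE_pos {b x : ℝ} (hb : 0 ≤ b) (hx : 0 < x) : 0 < EE b x := by
  have hp : ∀ k : ℕ, 0 < x ^ ((k:ℝ) + b) / Real.Gamma ((k:ℝ) + b + 1) := fun k => by
    have := Real.Gamma_pos_of_pos (show (0:ℝ) < (k:ℝ)+b+1 by positivity)
    positivity
  exact (EE_summable hb hx).tsum_pos (fun k => (hp k).le) 0 (hp 0)

theorem half_EE_integrable {b x : ℝ} (hb : -(1/2) ≤ b) (hx : 0 < x) :
    IntervalIntegrable (fun t => (x - t) ^ (-(1:ℝ)/2) * EE b t) volume 0 x := by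
  by_contra hc
  have h1 := half_EE hb hx
  rw [intervalIntegral.integral_undef hc] at h1
  have := Real.Gamma_pos_of_pos (show (0:ℝ) < 1/2 by norm_num)
  have := EE_pos (b := b + 1/2) (by linarith) hx
  have : 0 < Real.Gamma (1/2) * EE (b+1/2) x := by positivity
  linarith

theorem EE_zero' (x : ℝ) : EE 0 x = Real.exp x := by
  rw [EE, Real.exp_eq_exp_ℝ, NormedSpace.exp_eq_tsum_div]
  simp [Real.Gamma_nat_eq_factorial]

theorem EE_neg_half {x : ℝ} (hx : 0 < x) :
    EE (-(1/2)) x = x ^ (-(1/2) : ℝ) / Real.Gamma (1/2) + EE (1/2) x := by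
  have e : ∀ k : ℕ, x ^ (((k+1:ℕ):ℝ) + -(1/2)) / Real.Gamma (((k+1:ℕ):ℝ) + -(1/2) + 1) =
      x ^ ((k:ℝ) + 1/2) / Real.Gamma ((k:ℝ) + 1/2 + 1) := by
    intro k; push_cast; congr 2 <;> ring
  have hs : Summable fun k : ℕ => x ^ ((k:ℝ) + -(1/2)) / Real.Gamma ((k:ℝ) + -(1/2) + 1) := by
    rw [← summable_nat_add_iff 1]
    simp_rw [e]
    exact EE_summable (by norm_num) hx
  rw [EE, hs.tsum_eq_zero_add, EE]
  simp_rw [e]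
  norm_num

theorem Vstar_eq0 {x : ℝ} (hx : 0 < x) :
  (∑' k : ℕ, x ^ (k + 1) / (Nat.factorial (k + 1) : ℝ)) -
  ∑' k : ℕ, x ^ (((k : ℝ) + 1) + 1 / 2) / Real.Gamma (((k : ℝ) + 1) + 3 / 2) =
    Real.exp x - 1 - (EE (1/2) x - x ^ (1/2 : ℝ) / Real.Gamma (3/2)) := by
  have h1 : Real.exp x = 1 + ∑' k : ℕ, x ^ (k + 1) / (Nat.factorial (k + 1) : ℝ) := by
    rw [Real.exp_eq_exp_ℝ, NormedSpace.exp_eq_tsum_div]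
    simp only []
    rw [(Real.summable_pow_div_factorial x).tsum_eq_zero_add]
    simp
  have h2 : EE (1/2) x = x ^ (1/2 : ℝ) / Real.Gamma (3/2) +
      ∑' k : ℕ, x ^ (((k : ℝ) + 1) + 1 / 2) / Real.Gamma (((k : ℝ) + 1) + 3 / 2) := by
    rw [EE, (EE_summable (by norm_num) hx).tsum_eq_zero_add]
    congr 1
    · norm_num
    · congr 1; ext k; push_cast; congr 2; ring
  rw [h1, h2]; ring

/-- incomplete gamma -/
noncomputable def gam (x : ℝ) : ℝ := ∫ s in (0:ℝ)..x, Real.exp (-s) * s ^ ((1/2:ℝ) - 1)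

theorem EE_half {x : ℝ} (hx : 0 < x) : EE (1/2) x = Real.exp x * gam x / Real.Gamma (1/2) := by
  have h := half_EE (b := 0) (by norm_num) hx
  have hg := Real.Gamma_pos_of_pos (show (0:ℝ) < 1/2 by norm_num)
  rw [zero_add] at h
  rw [eq_div_iff hg.ne', mul_comm, ← h]
  simp_rw [EE_zero']
  rw [gam, ← intervalIntegral.integral_const_mul]
  have := intervalIntegral.integral_comp_sub_left (a := 0) (b := x)
    (fun t => (x - t) ^ (-(1:ℝ)/2) * Real.exp t) x
  rw [sub_self, sub_zero] at this
  rw [← this]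
  congr 1; ext t
  rw [sub_sub_cancel, sub_eq_add_neg x t, Real.exp_add]
  norm_num
  ring

theorem gam_ii (x : ℝ) (hx : 0 ≤ x) :
    IntervalIntegrable (fun s : ℝ => Real.exp (-s) * s ^ ((1/2:ℝ) - 1)) volume 0 x := by
  rw [intervalIntegrable_iff_integrableOn_Ioc_of_le hx]
  exact (Real.GammaIntegral_convergent (s := 1/2) (by norm_num)).mono_set Set.Ioc_subset_Ioi_self

theorem gam_cont : ContinuousOn gam (Set.Ici 0) := by
  intro x hx
  have hx : 0 ≤ x := hx
  have h := intervalIntegral.continuousOn_primitive_interval' (gam_ii (x+1) (by linarith))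
    (Set.left_mem_uIcc)
  rw [Set.uIcc_of_le (by linarith)] at h
  refine (h x ⟨hx, by linarith⟩).mono_of_mem_nhdsWithin ?_
  rw [← Set.Ici_inter_Iic]
  exact Filter.inter_mem self_mem_nhdsWithin
    (mem_nhdsWithin_of_mem_nhds (Iic_mem_nhds (by linarith)))

theorem gam_deriv {x : ℝ} (hx : 0 < x) :
    HasDerivAt gam (Real.exp (-x) * x ^ (-(1/2):ℝ)) x := by
  have hc : ∀ y ∈ Set.Ioi (0:ℝ), ContinuousAt (fun s : ℝ => Real.exp (-s) * s ^ ((1/2:ℝ) - 1)) y := by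
    intro y hy
    have : ContinuousAt (fun s : ℝ => s ^ ((1/2:ℝ) - 1)) y :=
      Real.continuousAt_rpow_const _ _ (Or.inl (ne_of_gt hy))
    exact (by fun_prop : ContinuousAt (fun s : ℝ => Real.exp (-s)) y).mul this
  have := intervalIntegral.integral_hasDerivAt_right (gam_ii x hx.le)
    (ContinuousAt.stronglyMeasurableAtFilter isOpen_Ioi hc x hx) (hc x hx)
  rw [show ((1/2:ℝ) - 1) = -(1/2) by norm_num] at this
  have e : gam = fun u => ∫ (s : ℝ) in (0:ℝ)..u, Real.exp (-s) * s ^ (-(1/2):ℝ) := by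
    funext u; rw [gam]; norm_num
  rw [e]; exact this

theorem gam_lt {x : ℝ} (hx : 0 < x) : gam x < Real.Gamma (1/2) := by
  have hm : StrictMonoOn gam (Set.Ici 0) := by
    apply strictMonoOn_of_deriv_pos (convex_Ici 0) gam_cont
    intro y hy
    rw [interior_Ici] at hy
    have hy : 0 < y := hy
    rw [(gam_deriv hy).deriv]; positivity
  refine (hm (Set.mem_Ici.2 hx.le) (Set.mem_Ici.2 (by linarith : 0 ≤ x+1)) (by linarith)).trans_le ?_
  rw [Real.Gamma_eq_integral (by norm_num), gam, intervalIntegral.integral_of_le (by linarith)]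
  apply setIntegral_mono_set (Real.GammaIntegral_convergent (s := 1/2) (by norm_num))
  · filter_upwards [ae_restrict_mem measurableSet_Ioi] with s hs
    have hs : 0 < s := hs
    simp only [Pi.zero_apply]; positivity
  · exact Set.Ioc_subset_Ioi_self.eventuallyLE

theorem Vstar_zero : Vstar 0 = 0 := by
  have h : ∀ k : ℕ, (0:ℝ) ^ (((k : ℝ) + 1) + 1 / 2) = 0 := fun k =>
    Real.zero_rpow (by positivity)
  simp only [Vstar, h]
  simp

theorem Gamma_three_half : Real.Gamma (3/2) = Real.Gamma (1/2) / 2 := by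
  rw [show (3/2:ℝ) = 1/2 + 1 by norm_num, Real.Gamma_add_one (by norm_num)]; ring

/-- closed form of `Vstar` -/
noncomputable def WW (x : ℝ) : ℝ :=
  Real.exp x - 1 - (Real.exp x * gam x / Real.Gamma (1/2)
    - x ^ (1/2 : ℝ) / (Real.Gamma (1/2) / 2))

theorem Vstar_eq_WW {x : ℝ} (hx : 0 ≤ x) : Vstar x = WW x := by
  rcases hx.eq_or_lt with h | h
  · subst h
    rw [Vstar_zero, WW, gam]
    norm_num
  · rw [Vstar, Vstar_eq0 h, EE_half h, Gamma_three_half, WW]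

theorem EE_half_deriv {x : ℝ} (hx : 0 < x) :
    HasDerivAt (fun y => Real.exp y * gam y / Real.Gamma (1/2)) (EE (-(1/2)) x) x := by
  have h := ((Real.hasDerivAt_exp x).mul (gam_deriv hx)).div_const (Real.Gamma (1/2))
  refine h.congr_deriv ?_
  rw [EE_neg_half hx, EE_half hx, ← mul_assoc, ← Real.exp_add]
  simp
  ring

theorem Vstar_deriv {x : ℝ} (hx : 0 < x) :
    HasDerivAt Vstar (Real.exp x - EE (1/2) x) x := by
  have h2 := (Real.hasDerivAt_rpow_const (x := x) (p := 1/2) (Or.inl hx.ne')).div_const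
    (Real.Gamma (1/2) / 2)
  have h := ((Real.hasDerivAt_exp x).sub_const 1).sub ((EE_half_deriv hx).sub h2)
  have h' : HasDerivAt WW (Real.exp x - EE (1/2) x) x := by
    refine h.congr_deriv ?_
    have hg := (Real.Gamma_pos_of_pos (show (0:ℝ) < 1/2 by norm_num)).ne'
    rw [EE_neg_half hx, show (1/2:ℝ) - 1 = -(1/2) by norm_num]
    field_simp
    ring
  refine h'.congr_of_eventuallyEq ?_
  filter_upwards [Ioi_mem_nhds hx] with y hy
  exact Vstar_eq_WW (le_of_lt hy)

theorem Vstar_deriv2 {x : ℝ} (hx : 0 < x) :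
    HasDerivAt (fun y => Real.exp y - EE (1/2) y) (EE 0 x - EE (-(1/2)) x) x := by
  rw [EE_zero']
  refine ((Real.hasDerivAt_exp x).sub (EE_half_deriv hx)).congr_of_eventuallyEq ?_
  filter_upwards [Ioi_mem_nhds hx] with y hy
  simp only [Pi.sub_apply]
  rw [EE_half hy]

theorem Vstar_pos {x : ℝ} (hx : 0 < x) : 0 < Vstar x := by
  have hc : ContinuousOn Vstar (Set.Ici 0) := by
    have : ContinuousOn WW (Set.Ici 0) := by
      unfold WW
      have h1 := gam_cont
      have h2 : Continuous fun x : ℝ => x ^ (1/2:ℝ) := Real.continuous_rpow_const (by norm_num)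
      have h3 := h2.continuousOn (s := Set.Ici 0)
      exact (Real.continuous_exp.continuousOn.sub continuousOn_const).sub
        (((Real.continuous_exp.continuousOn.mul h1).div_const _).sub (h3.div_const _))
    exact this.congr fun y hy => Vstar_eq_WW hy
  have hm : StrictMonoOn Vstar (Set.Ici 0) := by
    apply strictMonoOn_of_deriv_pos (convex_Ici 0) hc
    intro y hy
    rw [interior_Ici] at hy
    have hy : 0 < y := hy
    have hg := (Real.Gamma_pos_of_pos (show (0:ℝ) < 1/2 by norm_num))
    rw [(Vstar_deriv hy).deriv, EE_half hy, sub_pos, div_lt_iff₀ hg]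
    exact mul_lt_mul_of_pos_left (gam_lt hy) (Real.exp_pos y)
  have := hm (Set.mem_Ici.2 le_rfl) (Set.mem_Ici.2 hx.le) hx
  rwa [Vstar_zero] at this

theorem half_V2 {x : ℝ} (hx : 0 < x) :
    ∫ t in (0:ℝ)..x, (x - t) ^ (-(1:ℝ)/2) * (EE 0 t - EE (-(1/2)) t)
      = -(Real.Gamma (1/2) * (Real.exp x - EE (1/2) x)) := by
  simp_rw [mul_sub]
  rw [intervalIntegral.integral_sub (half_EE_integrable (by norm_num) hx)
    (half_EE_integrable le_rfl hx), half_EE (by norm_num) hx, half_EE le_rfl hx,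
    zero_add, neg_add_cancel, EE_zero']
  ring

theorem half_scaled {l x : ℝ} (hl : 0 < l) (hx : 0 < x) :
    ∫ t in (0:ℝ)..x, (x - t) ^ (-(1:ℝ)/2) * (EE 0 (l*t) - EE (-(1/2)) (l*t))
      = -(l ^ (-(1:ℝ)/2) * (Real.Gamma (1/2) * (Real.exp (l*x) - EE (1/2) (l*x)))) := by
  have h := half_V2 (mul_pos hl hx)
  have hs := intervalIntegral.integral_comp_mul_left (a := 0) (b := x)
    (fun t => (l*x - t) ^ (-(1:ℝ)/2) * (EE 0 t - EE (-(1/2)) t)) hl.ne'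
  rw [mul_zero, h, smul_eq_mul] at hs
  have e : (∫ t in (0:ℝ)..x, (l*x - l*t) ^ (-(1:ℝ)/2) * (EE 0 (l*t) - EE (-(1/2)) (l*t)))
      = l ^ (-(1:ℝ)/2) *
        ∫ t in (0:ℝ)..x, (x - t) ^ (-(1:ℝ)/2) * (EE 0 (l*t) - EE (-(1/2)) (l*t)) := by
    rw [← intervalIntegral.integral_const_mul]
    apply intervalIntegral.integral_congr
    intro t ht
    rw [Set.uIcc_of_le hx.le] at ht
    simp only []
    rw [← mul_sub, Real.mul_rpow hl.le (by linarith [ht.2])]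
    ring
  rw [e] at hs
  have hp := Real.rpow_pos_of_pos hl (-(1:ℝ)/2)
  have hq : l ^ (-(1:ℝ)/2) * l ^ (-(1:ℝ)/2) = l⁻¹ := by
    rw [← Real.rpow_add hl, ← Real.rpow_neg_one]; norm_num
  apply mul_left_cancel₀ hp.ne'
  rw [hs, ← hq]; ring

theorem u_deriv {ε x : ℝ} (hε : 0 < ε) (hx : 0 < x) :
    HasDerivAt (uFrac ε) (1 - (1/ε^2) * (Real.exp (1/ε^2 * x) - EE (1/2) (1/ε^2 * x))
      / Vstar (1/ε^2)) x := by
  have hl : 0 < 1/ε^2 := by positivity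
  have h := (Vstar_deriv (mul_pos hl hx)).comp x ((hasDerivAt_id x).const_mul (1/ε^2))
  have h2 := (hasDerivAt_id x).sub (h.div_const (Vstar (1/ε^2)))
  have e : uFrac ε = fun x => x - Vstar (1/ε^2 * x) / Vstar (1/ε^2) := by
    funext y; rw [uFrac, div_mul_eq_mul_div, one_mul]
  rw [e]
  exact h2.congr_deriv (by ring)

theorem u_deriv2 {ε x : ℝ} (hε : 0 < ε) (hx : 0 < x) :
    deriv (deriv (uFrac ε)) x = -((1/ε^2)^2 / Vstar (1/ε^2)) *
      (EE 0 (1/ε^2 * x) - EE (-(1/2)) (1/ε^2 * x)) := by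
  have hl : 0 < 1/ε^2 := by positivity
  have h := (Vstar_deriv2 (mul_pos hl hx)).comp x ((hasDerivAt_id x).const_mul (1/ε^2))
  have h2 := ((h.const_mul (1/ε^2)).div_const (Vstar (1/ε^2))).const_sub 1
  have h3 : HasDerivAt (deriv (uFrac ε)) (-((1/ε^2)^2 / Vstar (1/ε^2)) *
      (EE 0 (1/ε^2 * x) - EE (-(1/2)) (1/ε^2 * x))) x := by
    refine (h2.congr_of_eventuallyEq ?_).congr_deriv (by ring)
    filter_upwards [Ioi_mem_nhds hx] with y hy
    rw [(u_deriv hε hy).deriv]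
    rfl
  exact h3.deriv

/-- `u` satisfies `u(0) = u(1) = 0` and
`−ε D^{3/2}_* u − u' = −1` on `(0,1)`, where
`D^{3/2}_* u(x) = (1/Γ(1/2)) ∫_0^x (x−t)^{−1/2} u''(t) dt`. -/
theorem stmt_11 (ε : ℝ) (hε : 0 < ε) :
    uFrac ε 0 = 0 ∧ uFrac ε 1 = 0 ∧
      ∀ x ∈ Set.Ioo (0 : ℝ) 1,
        -ε * ((1 / Real.Gamma (1 / 2)) *
            ∫ t in (0 : ℝ)..x, (x - t) ^ (-(1 : ℝ) / 2) * deriv (deriv (uFrac ε)) t) -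
          deriv (uFrac ε) x = -1 := by
  have hl : 0 < 1/ε^2 := by positivity
  have hV := (Vstar_pos hl).ne'
  refine ⟨by simp [uFrac, Vstar_zero], by rw [uFrac, div_self hV, sub_self], ?_⟩
  intro x hx
  have hx0 := hx.1
  have hI : (∫ t in (0 : ℝ)..x, (x - t) ^ (-(1 : ℝ) / 2) * deriv (deriv (uFrac ε)) t) =
      -((1/ε^2)^2 / Vstar (1/ε^2)) * ∫ t in (0:ℝ)..x, (x - t) ^ (-(1:ℝ)/2) *
        (EE 0 (1/ε^2*t) - EE (-(1/2)) (1/ε^2*t)) := by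
    rw [← intervalIntegral.integral_const_mul, intervalIntegral.integral_of_le hx0.le,
      intervalIntegral.integral_of_le hx0.le]
    apply setIntegral_congr_fun measurableSet_Ioc
    intro t ht
    simp only []
    rw [u_deriv2 hε ht.1]
    ring
  have hr : (1/ε^2) ^ (-(1:ℝ)/2) = ε := by
    rw [one_div, ← Real.rpow_natCast, ← Real.rpow_neg hε.le, ← Real.rpow_mul hε.le]
    norm_num
  rw [hI, half_scaled hl hx0, (u_deriv hε hx0).deriv, hr]
  have hg := (Real.Gamma_pos_of_pos (show (0:ℝ) < 1/2 by norm_num)).ne'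
  generalize Real.exp (1/ε^2 * x) - EE (1/2) (1/ε^2 * x) = A
  generalize Vstar (1/ε^2) = B at *
  generalize Real.Gamma (1/2) = C at *
  field_simp
  ring
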